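/- Let k be an even integer with k ≥ 4, and let s₁, s₂ ∈ ℂ satisfy Re(s₁) > −k/2 and Re(s₂) > −k/2. Then the iterated integral ∫_0^∞ ∫_0^∞ ( ∫_{-∞}^{∞} e^{2πi x u} (−u + i(y+1))^{−k} du ) y^{k/2 + s₂ − 1} x^{s₁ + s₂} dy dx converges and equals i^k (2π)^{−(s₁+s₂)} Γ(k/2 + s₁) Γ(k/2 + s₂) / Γ(k). -/

import Mathlib

open MeasureTheory Set

/-- The integrand of the Gamma integral with complex rate `c` is integrable. -/
lemma integrableOn_cpow_mul_exp_neg_mul_Ioi {a c : ℂ} (ha : 0 < a.re) (hc : 0 < c.re) :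
    IntegrableOn (fun t : ℝ => (t : ℂ) ^ (a - 1) * Complex.exp (-(c * t))) (Ioi 0) := by
  have h := integrableOn_rpow_mul_exp_neg_mul_rpow (s := (a - 1).re) (p := 1) (b := c.re)
    (by simpa using ha) one_pos hc
  refine Integrable.mono' h ?_ ?_
  · refine ContinuousOn.aestronglyMeasurable (fun t ht => ?_) measurableSet_Ioi
    refine ContinuousAt.continuousWithinAt (ContinuousAt.mul ?_ (by fun_prop))
    exact Complex.continuousAt_ofReal_cpow_const _ _ (Or.inr (ne_of_gt ht))
  · filter_upwards [ae_restrict_mem measurableSet_Ioi] with t ht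
    rw [norm_mul, Complex.norm_cpow_eq_rpow_re_of_pos ht, Complex.norm_exp]
    simp

/-- Natural powers in the Gamma integrand, with complex rate `c`. -/
lemma integrableOn_pow_mul_exp_neg_mul_Ioi (n : ℕ) {c : ℂ} (hc : 0 < c.re) :
    IntegrableOn (fun t : ℝ => (t : ℂ) ^ n * Complex.exp (-(c * t))) (Ioi 0) := by
  have h := integrableOn_cpow_mul_exp_neg_mul_Ioi (a := (n : ℂ) + 1) (c := c)
    (by simp; positivity) hc
  simpa using h

/-- The Laplace transform of a monomial, with complex rate `c`. -/
lemma integral_pow_mul_exp_neg_mul_Ioi_complex (n : ℕ) {c : ℂ} (hc : 0 < c.re) :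
    ∫ t : ℝ in Ioi 0, (t : ℂ) ^ n * Complex.exp (-(c * t)) = n.factorial / c ^ (n + 1) := by
  have hc0 : c ≠ 0 := by rintro rfl; simp at hc
  have hE (t : ℝ) : HasDerivAt (fun t : ℝ => Complex.exp (-(c * t)))
      (Complex.exp (-(c * t)) * -c) t := by
    have := ((Complex.ofRealCLM.hasDerivAt (x := t)).const_mul c).neg.cexp
    simpa using this
  have hT (m : ℕ) : Filter.Tendsto (fun t : ℝ => (t : ℂ) ^ m * Complex.exp (-(c * t)))
      Filter.atTop (nhds 0) := by
    rw [tendsto_zero_iff_norm_tendsto_zero]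
    refine (tendsto_rpow_mul_exp_neg_mul_atTop_nhds_zero m c.re hc).congr' ?_
    filter_upwards [Filter.eventually_gt_atTop 0] with t ht
    simp [Complex.norm_exp, abs_of_pos ht]
  induction n with
  | zero =>
    have i0 : IntegrableOn (fun t : ℝ => Complex.exp (-(c * t)) * -c) (Ioi 0) := by
      have := integrableOn_pow_mul_exp_neg_mul_Ioi 0 hc
      simp only [pow_zero, one_mul] at this
      exact Integrable.mul_const this (-c)
    have h := integral_Ioi_of_hasDerivAt_of_tendsto' (a := 0) (fun t _ => hE t) i0
      (by simpa using hT 0)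
    rw [integral_mul_const] at h
    simp only [mul_neg, Complex.ofReal_zero, mul_zero, neg_zero, Complex.exp_zero, zero_sub,
      neg_inj] at h
    simpa using eq_inv_of_mul_eq_one_left h
  | succ n ih =>
    have hP (t : ℝ) : HasDerivAt (fun t : ℝ => (t : ℂ) ^ (n + 1)) ((n + 1) * (t : ℂ) ^ n) t := by
      have := (Complex.ofRealCLM.hasDerivAt (x := t)).fun_pow (n + 1)
      simpa using this
    have hd (t : ℝ) : HasDerivAt (fun t : ℝ => (t : ℂ) ^ (n + 1) * Complex.exp (-(c * t)))
        ((n + 1) * ((t : ℂ) ^ n * Complex.exp (-(c * t)))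
          - c * ((t : ℂ) ^ (n + 1) * Complex.exp (-(c * t)))) t := by
      refine ((hP t).mul (hE t)).congr_deriv ?_
      ring
    have i1 := (integrableOn_pow_mul_exp_neg_mul_Ioi n hc).const_mul ((n : ℂ) + 1)
    have i2 := (integrableOn_pow_mul_exp_neg_mul_Ioi (n + 1) hc).const_mul c
    have h := integral_Ioi_of_hasDerivAt_of_tendsto' (a := 0) (fun t _ => hd t)
      (i1.sub i2) (hT (n + 1))
    rw [integral_sub i1 i2, integral_const_mul, integral_const_mul, ih] at h
    simp only [Complex.ofReal_zero, ne_eq, Nat.add_eq_zero_iff, one_ne_zero, and_false,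
      not_false_eq_true, zero_pow, zero_mul, sub_zero] at h
    rw [eq_div_iff (pow_ne_zero _ hc0), Nat.factorial_succ]
    push_cast
    have h' := sub_eq_zero.mp h
    field_simp at h'
    linear_combination -h'

open FourierTransform in
/-- Fourier inversion for the Gamma density `t ↦ t ^ n * exp (-2πat)` on the half line. -/
lemma integral_exp_mul_add_mul_I_inv_pow {n : ℕ} (hn : 1 ≤ n) {a x : ℝ} (ha : 1 ≤ a)
    (hx : 0 < x) :
    ∫ u : ℝ, Complex.exp (2 * Real.pi * Complex.I * x * u) * (((a : ℂ) + u * Complex.I) ^ (n + 1))⁻¹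
      = (2 * Real.pi : ℂ) ^ (n + 1) / n.factorial *
        ((x : ℂ) ^ n * Complex.exp (-(2 * Real.pi * a * x))) := by
  set f : ℝ → ℂ := (Ioi (0 : ℝ)).indicator
    (fun t : ℝ => (t : ℂ) ^ n * Complex.exp (-((2 * Real.pi * a : ℂ) * t))) with hf
  have hpi := Real.pi_pos
  have hf_int : Integrable f := by
    rw [hf, integrable_indicator_iff measurableSet_Ioi]
    refine integrableOn_pow_mul_exp_neg_mul_Ioi n ?_
    have : ((2 * Real.pi * a : ℂ)).re = 2 * Real.pi * a := by
      norm_cast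
    rw [this]; positivity
  have hF : 𝓕 f = fun u : ℝ => (n.factorial / (2 * Real.pi : ℂ) ^ (n + 1)) *
      (((a : ℂ) + u * Complex.I) ^ (n + 1))⁻¹ := by
    ext u
    rw [Real.fourier_real_eq_integral_exp_smul]
    have hre : 0 < ((2 * Real.pi : ℂ) * (a + u * Complex.I)).re := by
      have : (2 * Real.pi : ℂ) = ((2 * Real.pi : ℝ) : ℂ) := by push_cast; rfl
      rw [this, Complex.re_ofReal_mul]; simp; positivity
    have h := integral_pow_mul_exp_neg_mul_Ioi_complex n hre
    rw [mul_pow, ← div_div, div_eq_mul_inv (_ / _)] at h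
    rw [← h, ← integral_indicator measurableSet_Ioi]
    congr 1
    ext t
    by_cases ht : t ∈ Ioi (0 : ℝ)
    · simp only [hf, indicator_of_mem ht, smul_eq_mul]
      rw [mul_left_comm, ← Complex.exp_add]
      congr 2
      push_cast
      ring
    · simp [hf, indicator_of_notMem ht]
  have hF_int : Integrable (𝓕 f) := by
    rw [hF]
    refine Integrable.const_mul ?_ _
    have hne (u : ℝ) : (a : ℂ) + u * Complex.I ≠ 0 := by
      intro h
      have := congrArg Complex.re h
      simp at this
      linarith
    refine integrable_inv_one_add_sq.mono' (Continuous.aestronglyMeasurable ?_) ?_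
    · exact Continuous.inv₀ (by fun_prop) (fun u => pow_ne_zero _ (hne u))
    · refine Filter.Eventually.of_forall fun u => ?_
      rw [norm_inv, norm_pow]
      have hsq : 1 + u ^ 2 ≤ ‖(a : ℂ) + u * Complex.I‖ ^ 2 := by
        rw [Complex.sq_norm, Complex.normSq_add_mul_I]
        nlinarith
      have h1 : 1 ≤ ‖(a : ℂ) + u * Complex.I‖ := by
        by_contra! h
        nlinarith [norm_nonneg ((a : ℂ) + u * Complex.I), sq_nonneg u]
      gcongr
      exact hsq.trans (pow_le_pow_right₀ h1 (by omega))
  have hcont : ContinuousAt f x := by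
    have : ContinuousAt
        (fun t : ℝ => (t : ℂ) ^ n * Complex.exp (-((2 * Real.pi * a : ℂ) * t))) x := by
      fun_prop
    refine this.congr ?_
    filter_upwards [Ioi_mem_nhds hx] with t ht
    rw [hf, indicator_of_mem (show t ∈ Ioi (0 : ℝ) from ht)]
  have h := hf_int.fourierInv_fourier_eq hF_int hcont
  rw [hF, Real.fourierInv_eq', hf, indicator_of_mem (show x ∈ Ioi (0 : ℝ) from hx)] at h
  rw [← h, ← integral_const_mul]
  congr 1
  ext u
  have e : ((2 * Real.pi * inner ℝ u x : ℝ) : ℂ) * Complex.I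
      = 2 * Real.pi * Complex.I * x * u := by
    simp; ring
  rw [e, smul_eq_mul]
  have := Nat.factorial_ne_zero n
  have : (n.factorial : ℂ) ≠ 0 := by exact_mod_cast this
  have : (Real.pi : ℂ) ≠ 0 := by exact_mod_cast hpi.ne'
  field_simp

/-- The additive Fourier integral of `(-u + i(y+1)) ^ (-k)` for even `k`. -/
lemma integral_exp_mul_neg_add_I_zpow {k : ℕ} (hk : Even k) (hk2 : 2 ≤ k) {x y : ℝ}
    (hx : 0 < x) (hy : 0 ≤ y) :
    ∫ u : ℝ, Complex.exp (2 * Real.pi * Complex.I * x * u) *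
        (-(u : ℂ) + Complex.I * ((y : ℂ) + 1)) ^ (-(k : ℤ))
      = Complex.I ^ k * (2 * Real.pi : ℂ) ^ k / Complex.Gamma k *
        (x : ℂ) ^ (k - 1) * Complex.exp (-(2 * Real.pi * x)) *
          Complex.exp (-(2 * Real.pi * x * y)) := by
  obtain ⟨n, rfl⟩ : ∃ n, k = n + 1 := ⟨k - 1, by omega⟩
  have h := integral_exp_mul_add_mul_I_inv_pow (n := n) (by omega) (a := y + 1) (by linarith) hx
  have hI : (Complex.I ^ (n + 1))⁻¹ = Complex.I ^ (n + 1) := by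
    rw [← inv_pow, Complex.inv_I, hk.neg_pow]
  have hG : Complex.Gamma ((n + 1 : ℕ) : ℂ) = n.factorial := by
    push_cast; exact Complex.Gamma_nat_eq_factorial n
  calc _ = ∫ u : ℝ, Complex.I ^ (n + 1) * (Complex.exp (2 * Real.pi * Complex.I * x * u) *
        ((((y + 1 : ℝ) : ℂ) + u * Complex.I) ^ (n + 1))⁻¹) := by
        congr 1
        ext u
        have : -(u : ℂ) + Complex.I * (y + 1) =
            Complex.I * (((y + 1 : ℝ) : ℂ) + u * Complex.I) := by
          push_cast
          linear_combination -(u : ℂ) * Complex.I_mul_I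
        rw [this, zpow_neg, zpow_natCast, mul_pow, mul_inv, hI]
        ring
    _ = _ := by
        rw [integral_const_mul, h, hG]
        have e : Complex.exp (-(2 * Real.pi * ((y + 1 : ℝ) : ℂ) * x)) =
            Complex.exp (-(2 * Real.pi * x)) * Complex.exp (-(2 * Real.pi * x * y)) := by
          rw [← Complex.exp_add]; congr 1; push_cast; ring
        rw [e, Nat.add_sub_cancel]
        ring

/-- the archimedean evaluation in Lemma 4.3 of the paper.
For `k` even, `k ≥ 4`, and `Re s₁, Re s₂ > −k/2`, the iterated integral
`∫₀^∞ ∫₀^∞ (∫ℝ e^{2πixu}(−u+i(y+1))^{−k} du) y^{k/2+s₂−1} x^{s₁+s₂} dy dx`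
converges and equals `i^k (2π)^{−(s₁+s₂)} Γ(k/2+s₁)Γ(k/2+s₂)/Γ(k)`. -/
theorem stmt_1 (k : ℕ) (hk : Even k) (hk4 : 4 ≤ k) (s₁ s₂ : ℂ)
    (h1 : -(k : ℝ) / 2 < s₁.re) (h2 : -(k : ℝ) / 2 < s₂.re) :
    (∀ x ∈ Ioi (0 : ℝ), IntegrableOn (fun y : ℝ =>
        (∫ u : ℝ, Complex.exp (2 * Real.pi * Complex.I * x * u) *
            (-(u : ℂ) + Complex.I * ((y : ℂ) + 1)) ^ (-(k : ℤ))) *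
          (y : ℂ) ^ ((k : ℂ) / 2 + s₂ - 1) * (x : ℂ) ^ (s₁ + s₂)) (Ioi 0)) ∧
    IntegrableOn (fun x : ℝ => ∫ y in Ioi (0 : ℝ),
        (∫ u : ℝ, Complex.exp (2 * Real.pi * Complex.I * x * u) *
            (-(u : ℂ) + Complex.I * ((y : ℂ) + 1)) ^ (-(k : ℤ))) *
          (y : ℂ) ^ ((k : ℂ) / 2 + s₂ - 1) * (x : ℂ) ^ (s₁ + s₂)) (Ioi 0) ∧
    (∫ x in Ioi (0 : ℝ), ∫ y in Ioi (0 : ℝ),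
        (∫ u : ℝ, Complex.exp (2 * Real.pi * Complex.I * x * u) *
            (-(u : ℂ) + Complex.I * ((y : ℂ) + 1)) ^ (-(k : ℤ))) *
          (y : ℂ) ^ ((k : ℂ) / 2 + s₂ - 1) * (x : ℂ) ^ (s₁ + s₂)) =
      Complex.I ^ k * ((2 * Real.pi : ℝ) : ℂ) ^ (-(s₁ + s₂)) *
        Complex.Gamma ((k : ℂ) / 2 + s₁) * Complex.Gamma ((k : ℂ) / 2 + s₂) /
          Complex.Gamma (k : ℂ) := by
  have hpi := Real.pi_pos
  have hpiC : (Real.pi : ℂ) ≠ 0 := by exact_mod_cast hpi.ne'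
  have hα : 0 < ((k : ℂ) / 2 + s₁).re := by
    have : ((k : ℂ) / 2).re = (k : ℝ) / 2 := by simp
    rw [Complex.add_re, this]; linarith
  have hβ : 0 < ((k : ℂ) / 2 + s₂).re := by
    have : ((k : ℂ) / 2).re = (k : ℝ) / 2 := by simp
    rw [Complex.add_re, this]; linarith
  set C : ℂ := Complex.I ^ k * (2 * Real.pi : ℂ) ^ k / Complex.Gamma k with hC
  have hinner : ∀ x ∈ Ioi (0 : ℝ), ∀ y ∈ Ioi (0 : ℝ),
      (∫ u : ℝ, Complex.exp (2 * Real.pi * Complex.I * x * u) *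
            (-(u : ℂ) + Complex.I * ((y : ℂ) + 1)) ^ (-(k : ℤ))) *
          (y : ℂ) ^ ((k : ℂ) / 2 + s₂ - 1) * (x : ℂ) ^ (s₁ + s₂) =
        C * (x : ℂ) ^ (k - 1) * Complex.exp (-(2 * Real.pi * x)) * (x : ℂ) ^ (s₁ + s₂) *
          ((y : ℂ) ^ ((k : ℂ) / 2 + s₂ - 1) *
            Complex.exp (-(((2 * Real.pi * x : ℝ) : ℂ) * y))) := by
    intro x hx y hy
    rw [integral_exp_mul_neg_add_I_zpow hk (by omega) hx (le_of_lt hy)]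
    push_cast
    ring
  have hmid : ∀ x ∈ Ioi (0 : ℝ), (∫ y in Ioi (0 : ℝ),
        (∫ u : ℝ, Complex.exp (2 * Real.pi * Complex.I * x * u) *
            (-(u : ℂ) + Complex.I * ((y : ℂ) + 1)) ^ (-(k : ℤ))) *
          (y : ℂ) ^ ((k : ℂ) / 2 + s₂ - 1) * (x : ℂ) ^ (s₁ + s₂)) =
      C * ((2 * Real.pi : ℝ) : ℂ) ^ (-((k : ℂ) / 2 + s₂)) * Complex.Gamma ((k : ℂ) / 2 + s₂) *
        ((x : ℂ) ^ ((k : ℂ) / 2 + s₁ - 1) *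
          Complex.exp (-(((2 * Real.pi : ℝ) : ℂ) * x))) := by
    intro x hx
    have hx0 : (x : ℂ) ≠ 0 := by exact_mod_cast (ne_of_gt hx)
    have hx' : 0 < x := hx
    rw [setIntegral_congr_fun measurableSet_Ioi (hinner x hx), integral_const_mul,
      Complex.integral_cpow_mul_exp_neg_mul_Ioi hβ (by positivity : 0 < 2 * Real.pi * x)]
    have e1 : (1 / ((2 * Real.pi * x : ℝ) : ℂ)) ^ ((k : ℂ) / 2 + s₂) =
        ((2 * Real.pi : ℝ) : ℂ) ^ (-((k : ℂ) / 2 + s₂)) * (x : ℂ) ^ (-((k : ℂ) / 2 + s₂)) := by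
      rw [← Complex.mul_cpow_ofReal_nonneg (by positivity) hx'.le, one_div, Complex.inv_cpow,
        Complex.cpow_neg, Complex.ofReal_mul]
      rw [Complex.arg_ofReal_of_nonneg (by positivity)]
      exact hpi.ne
    have e2 : (x : ℂ) ^ (k - 1) * (x : ℂ) ^ (s₁ + s₂) * (x : ℂ) ^ (-((k : ℂ) / 2 + s₂)) =
        (x : ℂ) ^ ((k : ℂ) / 2 + s₁ - 1) := by
      rw [← Complex.cpow_natCast, ← Complex.cpow_add _ _ hx0, ← Complex.cpow_add _ _ hx0]
      congr 1
      rw [Nat.cast_sub (by omega)]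
      push_cast
      ring
    rw [e1, ← e2]
    push_cast
    ring
  refine ⟨fun x hx => ?_, ?_, ?_⟩
  · have hx' : 0 < x := hx
    refine (integrableOn_congr_fun (hinner x hx) measurableSet_Ioi).mpr ?_
    exact (integrableOn_cpow_mul_exp_neg_mul_Ioi hβ
      (by rw [Complex.ofReal_re]; positivity)).const_mul _
  · refine (integrableOn_congr_fun hmid measurableSet_Ioi).mpr ?_
    exact (integrableOn_cpow_mul_exp_neg_mul_Ioi hα
      (by rw [Complex.ofReal_re]; positivity)).const_mul _
  · rw [setIntegral_congr_fun measurableSet_Ioi hmid, integral_const_mul,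
      Complex.integral_cpow_mul_exp_neg_mul_Ioi hα (by positivity : 0 < 2 * Real.pi)]
    have h2pi : ((2 * Real.pi : ℝ) : ℂ) ≠ 0 := by exact_mod_cast (by positivity)
    have e1 : (1 / ((2 * Real.pi : ℝ) : ℂ)) ^ ((k : ℂ) / 2 + s₁) =
        ((2 * Real.pi : ℝ) : ℂ) ^ (-((k : ℂ) / 2 + s₁)) := by
      rw [one_div, Complex.inv_cpow, Complex.cpow_neg]
      rw [Complex.arg_ofReal_of_nonneg (by positivity)]
      exact hpi.ne
    have e2 : ((2 * Real.pi : ℝ) : ℂ) ^ k * ((2 * Real.pi : ℝ) : ℂ) ^ (-((k : ℂ) / 2 + s₂)) *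
        ((2 * Real.pi : ℝ) : ℂ) ^ (-((k : ℂ) / 2 + s₁)) =
          ((2 * Real.pi : ℝ) : ℂ) ^ (-(s₁ + s₂)) := by
      rw [← Complex.cpow_natCast, ← Complex.cpow_add _ _ h2pi, ← Complex.cpow_add _ _ h2pi]
      congr 1
      ring
    rw [e1, ← e2, hC]
    push_cast
    ring
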